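/- Multivariate Voronovskaya asymptotic formula: Let f : [0,1]^n -> R be twice continuously differentiable and let x be a point in [0,1]^n. Then the limit as m tends to infinity of m * ( B_{m,...,m}(f)(x) - f(x) ) equals the sum over j = 1,...,n of ( x_j * (1 - x_j) / 2 ) * (second partial derivative of f with respect to x_j, evaluated at x). -/

import Mathlib

open Finset

/-- Partial derivative of `g : ℝⁿ → ℝ` in the `j`-th coordinate direction. -/
noncomputable def pder {n : ℕ} (j : Fin n) (g : (Fin n → ℝ) → ℝ) : (Fin n → ℝ) → ℝ :=
  fun x => deriv (fun t : ℝ => g (Function.update x j t)) (x j)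

/-- The multivariate Bernstein polynomial of `f : [0,1]ⁿ → ℝ` with degrees `m₁, …, mₙ`. -/
noncomputable def mvBernstein {n : ℕ} (m : Fin n → ℕ) (f : (Fin n → ℝ) → ℝ)
    (x : Fin n → ℝ) : ℝ :=
  ∑ k ∈ Fintype.piFinset (fun j => Finset.range (m j + 1)),
    f (fun j => (k j : ℝ) / (m j : ℝ)) *
      ∏ j, (((m j).choose (k j) : ℝ) * x j ^ (k j) * (1 - x j) ^ (m j - k j))

/-- The univariate Bernstein polynomial of degree `m` of `g`. -/
noncomputable def univBernstein (m : ℕ) (g : ℝ → ℝ) (x : ℝ) : ℝ :=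
  ∑ k ∈ Finset.range (m + 1),
    g ((k : ℝ) / (m : ℝ)) * ((m.choose k : ℝ) * x ^ k * (1 - x) ^ (m - k))

/-- The `p`-th central moment of the binomial distribution with parameters `m` and `x`. -/
noncomputable def binomialMoment (m p : ℕ) (x : ℝ) : ℝ :=
  ∑ k ∈ Finset.range (m + 1),
    (m.choose k : ℝ) * (x ^ k * (1 - x) ^ (m - k) * ((k : ℝ) - m * x) ^ p)

theorem sum_range_choose_succ_mul (m : ℕ) (x y : ℝ) (g : ℕ → ℝ) :
    ∑ k ∈ Finset.range (m + 2), ((m + 1).choose k : ℝ) * (x ^ k * y ^ (m + 1 - k) * g k) =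
      y * ∑ k ∈ Finset.range (m + 1), (m.choose k : ℝ) * (x ^ k * y ^ (m - k) * g k) +
      x * ∑ k ∈ Finset.range (m + 1), (m.choose k : ℝ) * (x ^ k * y ^ (m - k) * g (k + 1)) := by
  have h := Finset.sum_antidiagonal_choose_succ_mul (fun i j => x ^ i * y ^ j * g i) m
  rw [Finset.Nat.sum_antidiagonal_eq_sum_range_succ_mk,
    Finset.Nat.sum_antidiagonal_eq_sum_range_succ_mk,
    Finset.Nat.sum_antidiagonal_eq_sum_range_succ_mk] at h
  rw [h, Finset.mul_sum, Finset.mul_sum]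
  congr 1
  · exact Finset.sum_congr rfl fun k _ => by ring
  · refine Finset.sum_congr rfl fun k hk => ?_
    rw [Nat.choose_symm (by grind)]
    ring

theorem sum_choose_mul_add_pow (m p : ℕ) (x c : ℝ) :
    ∑ k ∈ Finset.range (m + 1),
        (m.choose k : ℝ) * (x ^ k * (1 - x) ^ (m - k) * ((k : ℝ) - m * x + c) ^ p) =
      ∑ i ∈ Finset.range (p + 1), binomialMoment m i x * c ^ (p - i) * (p.choose i : ℝ) := by
  simp only [binomialMoment, add_pow, Finset.mul_sum, Finset.sum_mul]
  rw [Finset.sum_comm]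
  exact Finset.sum_congr rfl fun i _ => Finset.sum_congr rfl fun k _ => by ring

theorem binomialMoment_succ (m p : ℕ) (x : ℝ) :
    binomialMoment (m + 1) p x =
      (1 - x) * ∑ i ∈ Finset.range (p + 1),
        binomialMoment m i x * (-x) ^ (p - i) * (p.choose i : ℝ) +
      x * ∑ i ∈ Finset.range (p + 1),
        binomialMoment m i x * (1 - x) ^ (p - i) * (p.choose i : ℝ) := by
  rw [← sum_choose_mul_add_pow, ← sum_choose_mul_add_pow, binomialMoment,
    sum_range_choose_succ_mul]
  push_cast
  congr 2 <;> refine Finset.sum_congr rfl fun k _ => ?_ <;> ring_nf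

theorem binomialMoment_values (m : ℕ) (x : ℝ) :
    binomialMoment m 0 x = 1 ∧ binomialMoment m 1 x = 0 ∧
    binomialMoment m 2 x = m * (x * (1 - x)) ∧
    binomialMoment m 3 x = m * (x * (1 - x)) * (1 - 2 * x) ∧
    binomialMoment m 4 x =
      3 * m ^ 2 * (x * (1 - x)) ^ 2 + m * (x * (1 - x)) * (1 - 6 * (x * (1 - x))) := by
  induction m with
  | zero => simp [binomialMoment]
  | succ m ih =>
    obtain ⟨h0, h1, h2, h3, h4⟩ := ih
    simp only [binomialMoment_succ, Finset.sum_range_succ, Finset.sum_range_zero, h0, h1, h2, h3,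
      h4]
    norm_num [Nat.choose]
    refine ⟨?_, ?_, ?_, ?_⟩ <;> ring

theorem univBernstein_sub_pow {m : ℕ} (hm : m ≠ 0) (p : ℕ) (x : ℝ) :
    univBernstein m (fun t => (t - x) ^ p) x = binomialMoment m p x / m ^ p := by
  have hm' : (m : ℝ) ≠ 0 := Nat.cast_ne_zero.mpr hm
  rw [univBernstein, binomialMoment, Finset.sum_div]
  refine Finset.sum_congr rfl fun k _ => ?_
  rw [show (k : ℝ) / m - x = (k - m * x) / m by field_simp, div_pow]
  ring

theorem univBernstein_one (m : ℕ) (x : ℝ) : univBernstein m (fun _ => 1) x = 1 := by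
  refine Eq.trans ?_ (binomialMoment_values m x).1
  simp [univBernstein, binomialMoment, mul_assoc]

section mvBernstein

variable {n : ℕ} (m : Fin n → ℕ) (x : Fin n → ℝ)

theorem mvBernstein_add (f g : (Fin n → ℝ) → ℝ) :
    mvBernstein m (fun y => f y + g y) x = mvBernstein m f x + mvBernstein m g x := by
  simp only [mvBernstein, add_mul, Finset.sum_add_distrib]

theorem mvBernstein_const_mul (c : ℝ) (f : (Fin n → ℝ) → ℝ) :
    mvBernstein m (fun y => c * f y) x = c * mvBernstein m f x := by
  simp only [mvBernstein, Finset.mul_sum, mul_assoc]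

theorem mvBernstein_sum {ι : Type*} (s : Finset ι) (f : ι → (Fin n → ℝ) → ℝ) :
    mvBernstein m (fun y => ∑ i ∈ s, f i y) x = ∑ i ∈ s, mvBernstein m (f i) x := by
  simp only [mvBernstein, Finset.sum_mul]
  rw [Finset.sum_comm]

theorem mvBernstein_prod (g : Fin n → ℝ → ℝ) :
    mvBernstein m (fun y => ∏ j, g j (y j)) x = ∏ j, univBernstein (m j) (g j) (x j) := by
  simp only [mvBernstein, univBernstein, ← Finset.prod_mul_distrib]
  rw [Finset.prod_univ_sum]

theorem mvBernstein_const (c : ℝ) : mvBernstein m (fun _ => c) x = c := by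
  have h := mvBernstein_prod m x fun _ _ => 1
  simp only [univBernstein_one, Finset.prod_const_one] at h
  simpa [h] using mvBernstein_const_mul m x c fun _ => 1

theorem mvBernstein_coord (i : Fin n) (g : ℝ → ℝ) :
    mvBernstein m (fun y => g (y i)) x = univBernstein (m i) g (x i) := by
  have h := mvBernstein_prod m x fun l t => if l = i then g t else 1
  have h' : ∀ l, univBernstein (m l) (fun t => if l = i then g t else 1) (x l) =
      if l = i then univBernstein (m l) g (x l) else 1 := fun l => by
    split_ifs <;> simp [univBernstein_one]
  simpa [h'] using h

theorem mvBernstein_sub_mul_sub {m : Fin n → ℕ} {i j : Fin n} (hm : m i ≠ 0) (hij : i ≠ j) :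
    mvBernstein m (fun y => (y i - x i) * (y j - x j)) x = 0 := by
  have h := mvBernstein_prod m x fun l t =>
    (if l = i then t - x l else 1) * (if l = j then t - x l else 1)
  have h0 : univBernstein (m i) (fun t => t - x i) (x i) = 0 := by
    simpa [(binomialMoment_values (m i) (x i)).2.1] using univBernstein_sub_pow hm 1 (x i)
  rw [Finset.prod_eq_zero (Finset.mem_univ i) (by simpa [hij] using h0)] at h
  simpa only [Finset.prod_mul_distrib, Finset.prod_ite_eq', Finset.mem_univ, if_true] using h

variable {x}

theorem mvBernstein_mono (hx : x ∈ Set.Icc (0 : Fin n → ℝ) 1) {f g : (Fin n → ℝ) → ℝ}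
    (hfg : ∀ y ∈ Set.Icc (0 : Fin n → ℝ) 1, f y ≤ g y) :
    mvBernstein m f x ≤ mvBernstein m g x := by
  refine Finset.sum_le_sum fun k hk => ?_
  rw [Fintype.mem_piFinset] at hk
  refine mul_le_mul_of_nonneg_right (hfg _ ⟨fun j => ?_, fun j => ?_⟩)
    (Finset.prod_nonneg fun j _ => ?_)
  · simp only [Pi.zero_apply]
    positivity
  · have : k j ≤ m j := Nat.lt_succ_iff.mp (Finset.mem_range.mp (hk j))
    exact div_le_one_of_le₀ (Nat.cast_le.mpr this) (by positivity)
  · have h0 : 0 ≤ x j := hx.1 j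
    have h1 : 0 ≤ 1 - x j := sub_nonneg.mpr (hx.2 j)
    positivity

theorem abs_mvBernstein_le (hx : x ∈ Set.Icc (0 : Fin n → ℝ) 1) {f g : (Fin n → ℝ) → ℝ}
    (hfg : ∀ y ∈ Set.Icc (0 : Fin n → ℝ) 1, |f y| ≤ g y) :
    |mvBernstein m f x| ≤ mvBernstein m g x := by
  refine abs_le.mpr ⟨?_, mvBernstein_mono m hx fun y hy => (abs_le.mp (hfg y hy)).2⟩
  have h := mvBernstein_mono m hx fun y hy => (abs_le.mp (hfg y hy)).1
  have h' := mvBernstein_const_mul m x (-1) g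
  simp only [neg_one_mul] at h'
  rwa [h'] at h

end mvBernstein

/-- The second-order Taylor formula with Peano remainder, within a convex set. -/
theorem ContDiffOn.taylor_two_isLittleO {E : Type*} [NormedAddCommGroup E] [NormedSpace ℝ E]
    {f : E → ℝ} {s : Set E} (hf : ContDiffOn ℝ 2 f s) (hs : Convex ℝ s)
    (hne : (interior s).Nonempty) {x : E} (hx : x ∈ s) :
    (fun y => f y - f x - fderivWithin ℝ f s x (y - x) -
        1 / 2 * fderivWithin ℝ (fderivWithin ℝ f s) s x (y - x) (y - x))
      =o[nhdsWithin x s] fun y => ‖y - x‖ ^ 2 := by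
  have hu : UniqueDiffOn ℝ s := uniqueDiffOn_convex hs hne
  have hsymm : IsSymmSndFDerivWithinAt ℝ f s x :=
    (hf x hx).isSymmSndFDerivWithinAt (by simp) hu
      (by rw [hs.closure_interior_eq_closure_of_nonempty_interior hne]; exact subset_closure hx) hx
  have hF : HasFDerivWithinAt (fderivWithin ℝ f s)
      (fderivWithin ℝ (fderivWithin ℝ f s) s x) s x :=
    (((hf.fderivWithin hu (m := 1) (by norm_num)).differentiableOn (by norm_num)) x
      hx).hasFDerivWithinAt
  set L := fderivWithin ℝ f s with hL
  set Q := fderivWithin ℝ L s x with hQ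
  set φ : E → ℝ := fun y => f y - f x - L x (y - x) - 1 / 2 * Q (y - x) (y - x) with hφ
  have hφ' : ∀ z ∈ s, HasFDerivWithinAt φ (L z - L x - Q (z - x)) s z := fun z hz => by
    have hfz : HasFDerivWithinAt f (L z) s z :=
      (hf.differentiableOn (by norm_num) z hz).hasFDerivWithinAt
    have hid : HasFDerivWithinAt (fun y : E => y - x) (ContinuousLinearMap.id ℝ E) s z :=
      (hasFDerivWithinAt_id z s).sub_const x
    have hLz := (L x).hasFDerivAt.comp_hasFDerivWithinAt z hid
    have hQz := (Q.hasFDerivAt.comp_hasFDerivWithinAt z hid).clm_apply hid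
    refine (((hfz.sub_const (f x)).sub hLz).sub (hQz.const_mul (1 / 2))).congr_fderiv ?_
    ext v
    have := hsymm (z - x) v
    rw [← hL, ← hQ] at this
    simp only [map_sub, sub_apply] at this
    simp
    linarith
  refine Asymptotics.isLittleO_iff.mpr fun ε hε => ?_
  have hev := Asymptotics.isLittleO_iff.mp hF.isLittleO hε
  obtain ⟨δ, hδ, hball⟩ := Metric.mem_nhdsWithin_iff.mp hev
  filter_upwards [inter_mem_nhdsWithin s (Metric.ball_mem_nhds x hδ)] with y hy
  have hyd : ‖y - x‖ < δ := by simpa [dist_eq_norm] using hy.2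
  have key := Convex.norm_image_sub_le_of_norm_hasFDerivWithin_le
    (f := φ) (f' := fun z => L z - L x - Q (z - x)) (C := ε * ‖y - x‖)
    (s := s ∩ Metric.closedBall x ‖y - x‖) (x := x) (y := y)
    (fun z hz => (hφ' z hz.1).mono Set.inter_subset_left)
    (fun z hz => by
      have hzy : ‖z - x‖ ≤ ‖y - x‖ := by simpa [dist_eq_norm] using hz.2
      have hzb : z ∈ Metric.ball x δ := by simpa [dist_eq_norm] using hzy.trans_lt hyd
      exact (hball ⟨hzb, hz.1⟩ : _ ≤ _).trans (by gcongr))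
    (hs.inter (convex_closedBall x _)) ⟨hx, by simp⟩ ⟨hy.1, by simp [dist_eq_norm]⟩
  have hφx : φ x = 0 := by simp [hφ]
  rw [hφx, sub_zero] at key
  refine key.trans (le_of_eq ?_)
  rw [norm_pow, norm_norm]
  ring

theorem IsCompact.exists_abs_le_of_isLittleO {E : Type*} [NormedAddCommGroup E]
    {R : E → ℝ} {s : Set E} {x : E} (hs : IsCompact s) (hR : ContinuousOn R s)
    (ho : R =o[nhdsWithin x s] fun y => ‖y - x‖ ^ 2) {ε : ℝ} (hε : 0 < ε) :
    ∃ C : ℝ, 0 ≤ C ∧ ∀ y ∈ s, |R y| ≤ ε * ‖y - x‖ ^ 2 + C * ‖y - x‖ ^ 4 := by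
  obtain ⟨δ, hδ, hball⟩ := Metric.mem_nhdsWithin_iff.mp (Asymptotics.isLittleO_iff.mp ho hε)
  obtain ⟨M, hM⟩ := hs.exists_bound_of_continuousOn hR
  refine ⟨|M| / δ ^ 4, by positivity, fun y hy => ?_⟩
  rcases lt_or_ge ‖y - x‖ δ with h | h
  · have hyb : y ∈ Metric.ball x δ := by simpa [dist_eq_norm] using h
    have : ‖R y‖ ≤ ε * ‖‖y - x‖ ^ 2‖ := hball ⟨hyb, hy⟩
    rw [norm_pow, norm_norm, Real.norm_eq_abs] at this
    exact this.trans (le_add_of_nonneg_right (by positivity))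
  · have h1 : |R y| ≤ |M| := (hM y hy).trans (le_abs_self M)
    have h2 : |M| ≤ |M| / δ ^ 4 * ‖y - x‖ ^ 4 := by
      rw [div_mul_eq_mul_div, le_div_iff₀ (by positivity)]
      gcongr
    exact (h1.trans h2).trans (le_add_of_nonneg_left (by positivity))

theorem interior_Icc_zero_one_pi_nonempty (n : ℕ) :
    (interior (Set.Icc (0 : Fin n → ℝ) 1)).Nonempty := by
  rw [← Set.pi_univ_Icc, interior_pi_set Set.finite_univ]
  exact ⟨fun _ => 1 / 2, fun i _ => by simp; norm_num⟩

theorem update_mem_Icc_zero_one {n : ℕ} {x : Fin n → ℝ} (hx : x ∈ Set.Icc (0 : Fin n → ℝ) 1)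
    (j : Fin n) {t : ℝ} (ht : t ∈ Set.Icc (0 : ℝ) 1) :
    Function.update x j t ∈ Set.Icc (0 : Fin n → ℝ) 1 :=
  ⟨le_update_iff.mpr ⟨ht.1, fun i _ => hx.1 i⟩, update_le_iff.mpr ⟨ht.2, fun i _ => hx.2 i⟩⟩

theorem HasFDerivWithinAt.hasDerivAt_comp_update {n : ℕ} {F : Type*} [NormedAddCommGroup F]
    [NormedSpace ℝ F] {g : (Fin n → ℝ) → F} {g' : (Fin n → ℝ) →L[ℝ] F} {x : Fin n → ℝ} {j : Fin n}
    (hg : HasFDerivWithinAt g g' (Set.Icc 0 1) x) (hx : x ∈ Set.Icc (0 : Fin n → ℝ) 1)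
    (hj : x j ∈ Set.Ioo (0 : ℝ) 1) :
    HasDerivAt (fun t => g (Function.update x j t)) (g' (Pi.single j 1)) (x j) := by
  have hg' : HasFDerivWithinAt g g' (Set.Icc 0 1) (Function.update x j (x j)) := by
    rwa [Function.update_eq_self]
  exact (hg'.comp_hasDerivWithinAt (x j) (hasDerivAt_update x j (x j)).hasDerivWithinAt
    fun t ht => update_mem_Icc_zero_one hx j ht).hasDerivAt (Icc_mem_nhds hj.1 hj.2)

theorem pder_pder_eq {n : ℕ} {f : (Fin n → ℝ) → ℝ}
    (hf : ContDiffOn ℝ 2 f (Set.Icc (0 : Fin n → ℝ) 1)) {x : Fin n → ℝ}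
    (hx : x ∈ Set.Icc (0 : Fin n → ℝ) 1) {j : Fin n} (hj : x j ∈ Set.Ioo (0 : ℝ) 1) :
    pder j (pder j f) x =
      fderivWithin ℝ (fderivWithin ℝ f (Set.Icc 0 1)) (Set.Icc 0 1) x
        (Pi.single j 1) (Pi.single j 1) := by
  have hu : UniqueDiffOn ℝ (Set.Icc (0 : Fin n → ℝ) 1) :=
    uniqueDiffOn_convex (convex_Icc 0 1) (interior_Icc_zero_one_pi_nonempty n)
  have hF := (((hf.fderivWithin hu (m := 1) (by norm_num)).differentiableOn (by norm_num)) x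
      hx).hasFDerivWithinAt.hasDerivAt_comp_update hx hj
  have hF' := hF.clm_apply (hasDerivAt_const (x j) (Pi.single j (1 : ℝ) : Fin n → ℝ))
  simp only [map_zero, add_zero] at hF'
  refine (hF'.congr_of_eventuallyEq ?_).deriv
  filter_upwards [Ioo_mem_nhds hj.1 hj.2] with t ht
  have hy := update_mem_Icc_zero_one hx j (Set.Ioo_subset_Icc_self ht)
  exact ((hf.differentiableOn (by norm_num) _ hy).hasFDerivWithinAt.hasDerivAt_comp_update hy
    (by simpa using ht)).deriv

section moments

variable {n : ℕ} {x : Fin n → ℝ} {m : ℕ}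

theorem mvBernstein_coord_sub_pow (hm : m ≠ 0) (i : Fin n) (p : ℕ) :
    mvBernstein (fun _ => m) (fun y => (y i - x i) ^ p) x = binomialMoment m p (x i) / m ^ p :=
  (mvBernstein_coord (fun _ => m) x i fun t => (t - x i) ^ p).trans
    (univBernstein_sub_pow hm p (x i))

theorem mvBernstein_linear (hm : m ≠ 0) (L : (Fin n → ℝ) →L[ℝ] ℝ) :
    mvBernstein (fun _ => m) (fun y => L (y - x)) x = 0 := by
  have hL : ∀ y, L (y - x) = ∑ i, L (Pi.single i 1) * (y i - x i) ^ 1 := fun y => by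
    conv_lhs => rw [pi_eq_sum_univ' (y - x)]
    simp [mul_comm]
  simp only [hL]
  rw [mvBernstein_sum]
  refine Finset.sum_eq_zero fun i _ => ?_
  rw [mvBernstein_const_mul, mvBernstein_coord_sub_pow hm, (binomialMoment_values m (x i)).2.1]
  simp

theorem mvBernstein_bilinear (hm : m ≠ 0) (Q : (Fin n → ℝ) →L[ℝ] (Fin n → ℝ) →L[ℝ] ℝ) :
    m * mvBernstein (fun _ => m) (fun y => Q (y - x) (y - x)) x =
      ∑ i, x i * (1 - x i) * Q (Pi.single i 1) (Pi.single i 1) := by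
  have hm' : (m : ℝ) ≠ 0 := Nat.cast_ne_zero.mpr hm
  have hQ : ∀ y, Q (y - x) (y - x) = ∑ i, ∑ j,
      Q (Pi.single i 1) (Pi.single j 1) * ((y i - x i) * (y j - x j)) := fun y => by
    have h : y - x = ∑ i, (y i - x i) • (Pi.single i 1 : Fin n → ℝ) := by
      ext l
      simp [Pi.single_apply]
    rw [h]
    simp only [map_sum, map_smul, _root_.sum_apply, smul_apply,
      smul_eq_mul, Finset.mul_sum]
    rw [Finset.sum_comm]
    exact Finset.sum_congr rfl fun i _ => Finset.sum_congr rfl fun j _ => by ring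
  simp only [hQ]
  rw [mvBernstein_sum, Finset.mul_sum]
  refine Finset.sum_congr rfl fun i _ => ?_
  rw [mvBernstein_sum, Finset.sum_eq_single i]
  · have h := mvBernstein_coord_sub_pow (x := x) hm i 2
    simp only [sq (_ - _)] at h
    rw [mvBernstein_const_mul, h, (binomialMoment_values m (x i)).2.2.1]
    field_simp
  · intro j _ hj
    rw [mvBernstein_const_mul, mvBernstein_sub_mul_sub (m := fun _ => m) x hm hj.symm, mul_zero]
  · simp

theorem norm_pow_le_sum_pow {n : ℕ} (v : Fin n → ℝ) {p : ℕ} (hp : Even p) (hp0 : p ≠ 0) :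
    ‖v‖ ^ p ≤ ∑ i, v i ^ p := by
  rcases isEmpty_or_nonempty (Fin n) with h | h
  · simp [Subsingleton.elim v 0, hp0]
  · obtain ⟨i, -, hi⟩ :=
      Finset.exists_mem_eq_sup Finset.univ Finset.univ_nonempty fun i => ‖v i‖₊
    have hv : ‖v‖ = |v i| := by rw [Pi.norm_def, hi, coe_nnnorm, Real.norm_eq_abs]
    rw [hv, hp.pow_abs]
    exact Finset.single_le_sum (f := fun i => v i ^ p) (fun j _ => hp.pow_nonneg (v j))
      (Finset.mem_univ i)

theorem mvBernstein_norm_pow_le (hm : m ≠ 0) (hx : x ∈ Set.Icc (0 : Fin n → ℝ) 1) {p : ℕ}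
    (hp : Even p) (hp0 : p ≠ 0) :
    mvBernstein (fun _ => m) (fun y => ‖y - x‖ ^ p) x ≤
      ∑ i, binomialMoment m p (x i) / m ^ p := by
  refine (mvBernstein_mono _ hx fun y _ => norm_pow_le_sum_pow (y - x) hp hp0).trans_eq ?_
  rw [mvBernstein_sum]
  exact Finset.sum_congr rfl fun i _ => mvBernstein_coord_sub_pow hm i p

theorem mul_mvBernstein_norm_sq_le (hm : m ≠ 0) (hx : x ∈ Set.Icc (0 : Fin n → ℝ) 1) :
    m * mvBernstein (fun _ => m) (fun y => ‖y - x‖ ^ 2) x ≤ n := by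
  have hm' : (m : ℝ) ≠ 0 := Nat.cast_ne_zero.mpr hm
  have h := mvBernstein_norm_pow_le hm hx even_two two_ne_zero
  refine (mul_le_mul_of_nonneg_left h m.cast_nonneg).trans ?_
  rw [Finset.mul_sum]
  refine (Finset.sum_le_card_nsmul _ _ 1 fun i _ => ?_).trans (by simp)
  rw [(binomialMoment_values m (x i)).2.2.1]
  have h0 : 0 ≤ x i := hx.1 i
  have h1 : x i ≤ 1 := hx.2 i
  field_simp
  nlinarith

theorem mul_mvBernstein_norm_pow_four_le (hm : m ≠ 0) (hx : x ∈ Set.Icc (0 : Fin n → ℝ) 1) :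
    m * mvBernstein (fun _ => m) (fun y => ‖y - x‖ ^ 4) x ≤ 4 * n / m := by
  have hm1 : (1 : ℝ) ≤ m := by exact_mod_cast Nat.one_le_iff_ne_zero.mpr hm
  have hm0 : (0 : ℝ) < m := by linarith
  have h := mvBernstein_norm_pow_le hm hx (by decide : Even 4) four_ne_zero
  refine (mul_le_mul_of_nonneg_left h m.cast_nonneg).trans ?_
  rw [Finset.mul_sum]
  refine (Finset.sum_le_card_nsmul _ _ (4 / m : ℝ) fun i _ => ?_).trans (le_of_eq ?_)
  · rw [(binomialMoment_values m (x i)).2.2.2.2]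
    have h0 : 0 ≤ x i := hx.1 i
    have h1 : x i ≤ 1 := hx.2 i
    have hq0 : 0 ≤ x i * (1 - x i) := mul_nonneg h0 (by linarith)
    have hq1 : x i * (1 - x i) ≤ 1 := by nlinarith
    generalize x i * (1 - x i) = q at hq0 hq1
    have hq2 : q ^ 2 ≤ 1 := pow_le_one₀ hq0 hq1
    have key : 3 * (m : ℝ) ^ 2 * q ^ 2 + m * q * (1 - 6 * q) ≤ 4 * m ^ 2 := by
      nlinarith [mul_le_mul_of_nonneg_left hq2 (sq_nonneg (m : ℝ)),
        mul_le_mul_of_nonneg_left hq1 hm0.le, mul_nonneg hm0.le (sq_nonneg q)]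
    calc (m : ℝ) * ((3 * (m : ℝ) ^ 2 * q ^ 2 + m * q * (1 - 6 * q)) / (m : ℝ) ^ 4)
        ≤ (m : ℝ) * (4 * (m : ℝ) ^ 2 / m ^ 4) := by gcongr
      _ = 4 / (m : ℝ) := by field_simp
  · simp
    ring

end moments

/-- **Multivariate Voronovskaya asymptotic formula.**  For `f : [0,1]ⁿ → ℝ` twice
continuously differentiable and `x ∈ [0,1]ⁿ`,
`lim_{m → ∞} m (B_{m,…,m}(f)(x) - f(x)) = ∑ⱼ (xⱼ(1-xⱼ)/2) ∂²f/∂xⱼ²(x)`. -/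
theorem mvBernstein_voronovskaya {n : ℕ} (f : (Fin n → ℝ) → ℝ)
    (hf : ContDiffOn ℝ 2 f (Set.Icc (0 : Fin n → ℝ) 1))
    (x : Fin n → ℝ) (hx : x ∈ Set.Icc (0 : Fin n → ℝ) 1) :
    Filter.Tendsto
      (fun m : ℕ => (m : ℝ) * (mvBernstein (fun _ => m) f x - f x))
      Filter.atTop
      (nhds (∑ j, x j * (1 - x j) / 2 * pder j (pder j f) x)) := by
  set S : Set (Fin n → ℝ) := Set.Icc 0 1
  set L := fderivWithin ℝ f S
  set Q := fderivWithin ℝ L S x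
  set R : (Fin n → ℝ) → ℝ :=
    fun y => f y - f x - L x (y - x) - 1 / 2 * Q (y - x) (y - x) with hR
  have hlim : ∑ j, x j * (1 - x j) / 2 * pder j (pder j f) x =
      1 / 2 * ∑ j, x j * (1 - x j) * Q (Pi.single j 1) (Pi.single j 1) := by
    rw [Finset.mul_sum]
    refine Finset.sum_congr rfl fun j _ => ?_
    rcases (hx.1 j : 0 ≤ x j).eq_or_lt with h0 | h0
    · simp [← h0]
    rcases (hx.2 j : x j ≤ 1).eq_or_lt with h1 | h1
    · simp [h1]
    rw [pder_pder_eq hf hx ⟨h0, h1⟩]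
    ring
  have hdecomp : ∀ m : ℕ, m ≠ 0 → (m : ℝ) * (mvBernstein (fun _ => m) f x - f x) =
      1 / 2 * ∑ j, x j * (1 - x j) * Q (Pi.single j 1) (Pi.single j 1) +
        m * mvBernstein (fun _ => m) R x := fun m hm => by
    have hf' : f = fun y => f x + (L x (y - x) + (1 / 2 * Q (y - x) (y - x) + R y)) := by
      ext y
      simp only [hR]
      ring
    have hB : mvBernstein (fun _ => m) f x =
        f x + (0 + (1 / 2 * mvBernstein (fun _ => m) (fun y => Q (y - x) (y - x)) x +
          mvBernstein (fun _ => m) R x)) := by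
      conv_lhs => rw [hf']
      rw [mvBernstein_add, mvBernstein_const, mvBernstein_add, mvBernstein_linear hm,
        mvBernstein_add, mvBernstein_const_mul]
    rw [hB, ← mvBernstein_bilinear hm]
    ring
  have hRo := hf.taylor_two_isLittleO (convex_Icc 0 1) (interior_Icc_zero_one_pi_nonempty n) hx
  have hRc : ContinuousOn R S := by
    have := hf.continuousOn
    fun_prop
  rw [hlim, Metric.tendsto_atTop]
  intro ε hε
  obtain ⟨C, hC, hbound⟩ := isCompact_Icc.exists_abs_le_of_isLittleO hRc hRo
    (show 0 < ε / (2 * (n + 1)) by positivity)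
  obtain ⟨N, hN⟩ := exists_nat_gt (C * (4 * n) / (ε / 2))
  refine ⟨N + 1, fun m hm => ?_⟩
  have hm0 : m ≠ 0 := by omega
  have hmN : (N : ℝ) < m := by exact_mod_cast hm
  have hmpos : (0 : ℝ) < m := by positivity
  rw [hdecomp m hm0, Real.dist_eq, add_sub_cancel_left, abs_mul, Nat.abs_cast]
  have h1 := abs_mvBernstein_le (fun _ => m) hx hbound
  rw [mvBernstein_add, mvBernstein_const_mul, mvBernstein_const_mul] at h1
  have h2 := mul_mvBernstein_norm_sq_le hm0 hx
  have h4 := mul_mvBernstein_norm_pow_four_le hm0 hx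
  have hfirst : ε / (2 * (n + 1)) * n ≤ ε / 2 := by
    rw [div_mul_eq_mul_div, div_le_div_iff₀ (by positivity) two_pos]
    nlinarith
  have hsecond : C * (4 * n / m) < ε / 2 := by
    rw [← mul_div_assoc, div_lt_comm₀ hmpos (by positivity)]
    exact hN.trans hmN
  calc (m : ℝ) * |mvBernstein (fun _ => m) R x|
      ≤ m * (ε / (2 * (n + 1)) * mvBernstein (fun _ => m) (fun y => ‖y - x‖ ^ 2) x +
          C * mvBernstein (fun _ => m) (fun y => ‖y - x‖ ^ 4) x) := by gcongr
    _ = ε / (2 * (n + 1)) * (m * mvBernstein (fun _ => m) (fun y => ‖y - x‖ ^ 2) x) +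
          C * (m * mvBernstein (fun _ => m) (fun y => ‖y - x‖ ^ 4) x) := by ring
    _ ≤ ε / (2 * (n + 1)) * n + C * (4 * n / m) := by gcongr
    _ < ε := by linarith
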